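/- For constants C > 0, d > 0, b ∈ ℝ, and η > 0, the Laplace-type integral ∫₀^η e^{−rt} t^b e^{−C/t^d} dt is asymptotically equivalent, as r → ∞, to μ r^{β−1} exp(−γ r^{d/(d+1)}), where μ = sqrt(2π (Cd)^{(2b+1)/(d+1)} / (d+1)), β = (d − 2b)/(2d + 2), and γ = ((d+1)/d^{d/(d+1)}) C^{1/(d+1)}. -/

import Mathlib

open MeasureTheory Filter Real

/-- The Laplace phase `s + s⁻ᵈ / d`, normalised to vanish at its minimiser `s = 1`. -/
noncomputable def laplacePhase (d s : ℝ) : ℝ := s - 1 + (s ^ (-d) - 1) / d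

lemma laplacePhase_one (d : ℝ) : laplacePhase d 1 = 0 := by
  simp [laplacePhase]

lemma sq_div_le_laplacePhase {d s : ℝ} (hd : 0 < d) (hs : 0 < s) :
    (s - 1) ^ 2 / (4 * (1 + |s - 1|)) ≤ laplacePhase d s := by
  have h_log : s - 1 - log s ≤ laplacePhase d s := by
    have h := add_one_le_exp (log s * -d)
    rw [← rpow_def_of_pos hs] at h
    have h' : -log s ≤ (s ^ (-d) - 1) / d := by
      rw [le_div_iff₀ hd]; linarith
    unfold laplacePhase; linarith
  refine le_trans ?_ h_log
  obtain ⟨x, hx, rfl⟩ : ∃ x : ℝ, 0 < x ∧ s = x ^ 2 := ⟨√s, sqrt_pos.2 hs, (sq_sqrt hs.le).symm⟩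
  have h1 : (x - 1) ^ 2 ≤ x ^ 2 - 1 - log (x ^ 2) := by
    have := log_le_sub_one_of_pos hx
    rw [log_pow]; push_cast; nlinarith
  refine le_trans ?_ h1
  rw [div_le_iff₀ (by positivity)]
  have h2 : (x + 1) ^ 2 ≤ 4 * (1 + |x ^ 2 - 1|) := by
    nlinarith [le_abs_self (x ^ 2 - 1), abs_nonneg (x ^ 2 - 1), sq_nonneg (x - 1)]
  nlinarith [mul_le_mul_of_nonneg_left h2 (sq_nonneg (x - 1))]

lemma exists_mul_log_le_half_add {b : ℝ} (hb : 0 ≤ b) :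
    ∃ K, ∀ x : ℝ, 0 < x → b * log x ≤ x / 2 + K := by
  rcases hb.eq_or_lt with rfl | hb
  · exact ⟨0, fun x hx => by simp; linarith⟩
  · refine ⟨b * log (2 * b), fun x hx => ?_⟩
    have h := log_le_sub_one_of_pos (show 0 < x / (2 * b) by positivity)
    rw [log_div hx.ne' (by positivity)] at h
    have h2 := mul_le_mul_of_nonneg_left h hb.le
    have h3 : b * (x / (2 * b) - 1) = x / 2 - b := by field_simp
    rw [h3] at h2
    linarith

lemma exists_rpow_le_exp_half_laplacePhase {d : ℝ} (b : ℝ) (hd : 0 < d) :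
    ∃ K, ∀ s : ℝ, 0 < s → s ^ b ≤ exp (laplacePhase d s / 2 + K) := by
  rcases le_total 0 b with hb | hb
  · obtain ⟨K, hK⟩ := exists_mul_log_le_half_add hb
    refine ⟨K + 1 / 2 + 1 / d / 2, fun s hs => ?_⟩
    rw [rpow_def_of_pos hs, exp_le_exp]
    have h1 := hK s hs
    have h2 : 0 ≤ s ^ (-d) / d := by positivity
    unfold laplacePhase
    rw [sub_div]
    linarith
  · obtain ⟨K, hK⟩ := exists_mul_log_le_half_add (neg_nonneg.2 hb)
    refine ⟨K / d + 1 / 2 + 1 / d / 2, fun s hs => ?_⟩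
    rw [rpow_def_of_pos hs, exp_le_exp]
    have h1 := hK (s ^ (-d)) (by positivity)
    rw [log_rpow hs] at h1
    have h2 : log s * b ≤ (s ^ (-d) / 2 + K) / d := by
      rw [le_div_iff₀ hd]; linarith
    have h3 : (s ^ (-d) / 2 + K) / d = s ^ (-d) / d / 2 + K / d := by ring
    unfold laplacePhase
    rw [sub_div]
    linarith

lemma tendsto_laplacePhase_div_sq {d : ℝ} (hd : 0 < d) :
    Tendsto (fun s => laplacePhase d s / (s - 1) ^ 2) (nhdsWithin 1 {1}ᶜ)
      (nhds ((d + 1) / 2)) := by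
  have h_pos : ∀ᶠ s : ℝ in nhdsWithin 1 {1}ᶜ, 0 < s :=
    nhdsWithin_le_nhds (lt_mem_nhds one_pos)
  have h_deriv : ∀ s : ℝ, 0 < s →
      HasDerivAt (laplacePhase d) (1 - s ^ (-d - 1)) s := by
    intro s hs
    have h := (((hasDerivAt_id s).sub_const 1).add
      (((hasDerivAt_rpow_const (p := -d) (Or.inl hs.ne')).sub_const 1).div_const d))
    rwa [neg_mul, neg_div, mul_div_cancel_left₀ _ hd.ne', ← sub_eq_add_neg] at h
  refine HasDerivAt.lhopital_zero_nhdsNE (f' := fun s => 1 - s ^ (-d - 1))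
    (g' := fun s => 2 * (s - 1)) ?_ ?_ ?_ ?_ ?_ ?_
  · filter_upwards [h_pos] with s hs using h_deriv s hs
  · refine Eventually.of_forall fun s => ?_
    have h := ((hasDerivAt_id' s).sub_const 1).fun_pow 2
    simpa using h
  · filter_upwards [self_mem_nhdsWithin] with s hs
    exact mul_ne_zero two_ne_zero (sub_ne_zero.2 hs)
  · have h := (h_deriv 1 one_pos).continuousAt.tendsto
    rw [laplacePhase_one] at h
    exact h.mono_left nhdsWithin_le_nhds
  · have h : Continuous fun s : ℝ => (s - 1) ^ 2 := by fun_prop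
    have h' := h.tendsto 1
    simp only [sub_self, ne_eq, OfNat.ofNat_ne_zero, not_false_eq_true, zero_pow] at h'
    exact h'.mono_left nhdsWithin_le_nhds
  · have h := (hasDerivAt_rpow_const (x := 1) (p := -d - 1) (Or.inl one_ne_zero)).tendsto_slope
    have h' := h.const_mul (-(1 / 2))
    convert h' using 1
    · ext s
      simp only [slope_def_field, one_rpow]
      rw [← div_div]
      ring
    · simp only [one_rpow]; congr 1; ring

lemma integrable_exp_neg_mul_abs {c : ℝ} (hc : 0 < c) :
    Integrable fun u : ℝ => exp (-c * |u|) := by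
  rw [← integrableOn_univ, ← Set.Iic_union_Ioi (a := (0 : ℝ))]
  refine IntegrableOn.union ?_ ?_
  · refine (integrableOn_exp_mul_Iic hc 0).congr_fun (fun u hu => ?_) measurableSet_Iic
    simp only [abs_of_nonpos (Set.mem_Iic.1 hu), neg_mul_neg]
  · refine (integrableOn_exp_mul_Ioi (neg_neg_iff_pos.2 hc) 0).congr_fun (fun u hu => ?_)
      measurableSet_Ioi
    simp only [abs_of_pos (Set.mem_Ioi.1 hu)]

/-- Laplace's method at the scale of the fluctuations around the minimiser of the phase. -/
lemma tendsto_integral_rescaled_laplace {ι : Type*} {l : Filter ι} [l.IsCountablyGenerated]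
    {d : ℝ} (b : ℝ) (hd : 0 < d) {A M : ι → ℝ} (hA : Tendsto A l atTop)
    (hM : Tendsto M l atTop) :
    Tendsto (fun i => ∫ u : ℝ, (Set.Ioc 0 (M i)).indicator
        (fun s => s ^ b * exp (-(A i * laplacePhase d s))) (1 + u / √(A i))) l
      (nhds √(2 * π / (d + 1))) := by
  obtain ⟨K, hK⟩ := exists_rpow_le_exp_half_laplacePhase b hd
  have h_gauss : ∫ u : ℝ, exp (-((d + 1) / 2) * u ^ 2) = √(2 * π / (d + 1)) := by
    rw [integral_gaussian]
    congr 1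
    field_simp
  rw [← h_gauss]
  refine tendsto_integral_filter_of_dominated_convergence
    (fun u => exp (K + 1 / 8) * exp (-(1 / 8) * |u|)) ?_ ?_ ?_ ?_
  · refine Eventually.of_forall fun i => Measurable.aestronglyMeasurable ?_
    have h_meas : Measurable (fun s : ℝ => s ^ b * exp (-(A i * laplacePhase d s))) := by
      unfold laplacePhase; fun_prop
    exact (h_meas.indicator measurableSet_Ioc).comp (by fun_prop)
  · filter_upwards [hA.eventually_ge_atTop 1] with i hi
    refine Eventually.of_forall fun u => ?_
    set s := 1 + u / √(A i) with hs_def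
    by_cases hs : s ∈ Set.Ioc 0 (M i)
    · rw [Set.indicator_of_mem hs, norm_of_nonneg (by have := hs.1; positivity), ← exp_add]
      have h_sqrt : 1 ≤ √(A i) := one_le_sqrt.2 hi
      have h_phase := sq_div_le_laplacePhase hd hs.1
      have h_phase_nonneg : 0 ≤ laplacePhase d s := le_trans (by positivity) h_phase
      have h_scaled : (|u| - 1) / 4 ≤ A i * laplacePhase d s := by
        have h_eq : s - 1 = u / √(A i) := by rw [hs_def]; ring
        have h_abs : |s - 1| ≤ |u| := by
          rw [h_eq, abs_div, abs_of_pos (by positivity : 0 < √(A i))]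
          exact div_le_self (abs_nonneg u) h_sqrt
        have h_sq : A i * (s - 1) ^ 2 = |u| ^ 2 := by
          rw [h_eq, div_pow, sq_sqrt (by linarith), sq_abs]
          field_simp
        calc (|u| - 1) / 4 ≤ |u| ^ 2 / (4 * (1 + |u|)) := by
              rw [le_div_iff₀ (by positivity)]; nlinarith
          _ ≤ |u| ^ 2 / (4 * (1 + |s - 1|)) := by gcongr
          _ = A i * ((s - 1) ^ 2 / (4 * (1 + |s - 1|))) := by rw [← h_sq]; ring
          _ ≤ A i * laplacePhase d s := by gcongr
      calc s ^ b * exp (-(A i * laplacePhase d s))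
          ≤ exp (laplacePhase d s / 2 + K) * exp (-(A i * laplacePhase d s)) := by
            gcongr; exact hK s hs.1
        _ = exp (laplacePhase d s / 2 + K + -(A i * laplacePhase d s)) := (exp_add _ _).symm
        _ ≤ exp (K + 1 / 8 + -(1 / 8) * |u|) := by
            rw [exp_le_exp]; nlinarith
    · rw [Set.indicator_of_notMem hs, norm_zero]
      positivity
  · refine Integrable.const_mul ?_ _
    exact integrable_exp_neg_mul_abs (by norm_num)
  · refine Eventually.of_forall fun u => ?_
    have h_sqrt : Tendsto (fun i => √(A i)) l atTop := tendsto_sqrt_atTop.comp hA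
    have h_one : Tendsto (fun i => 1 + u / √(A i)) l (nhds 1) := by
      simpa using (h_sqrt.const_div_atTop u).const_add 1
    have h_phase : Tendsto (fun i => A i * laplacePhase d (1 + u / √(A i))) l
        (nhds ((d + 1) / 2 * u ^ 2)) := by
      rcases eq_or_ne u 0 with rfl | hu
      · simpa [laplacePhase_one] using tendsto_const_nhds
      · have h_ne : Tendsto (fun i => 1 + u / √(A i)) l (nhdsWithin 1 {1}ᶜ) := by
          refine tendsto_nhdsWithin_iff.2 ⟨h_one, ?_⟩
          filter_upwards [h_sqrt.eventually_gt_atTop 0] with i hi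
          simp [hu, hi.ne']
        refine (((tendsto_laplacePhase_div_sq hd).comp h_ne).mul_const (u ^ 2)).congr' ?_
        filter_upwards [hA.eventually_gt_atTop 0] with i hi
        simp only [Function.comp_apply, add_sub_cancel_left, div_pow, sq_sqrt hi.le]
        field_simp
    have h_lim : Tendsto (fun i => (1 + u / √(A i)) ^ b *
        exp (-(A i * laplacePhase d (1 + u / √(A i))))) l
        (nhds (exp (-((d + 1) / 2) * u ^ 2))) := by
      have h := (h_one.rpow_const (p := b) (Or.inl one_ne_zero)).mul
        ((continuous_exp.tendsto _).comp h_phase.neg)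
      simpa using h
    refine h_lim.congr' ?_
    filter_upwards [h_one.eventually (lt_mem_nhds one_pos),
      h_one.eventually (gt_mem_nhds one_lt_two), hM.eventually_ge_atTop 2] with i h0 h2 h3
    have h_mem : 1 + u / √(A i) ∈ Set.Ioc 0 (M i) := ⟨h0, by linarith⟩
    rw [Set.indicator_of_mem h_mem]

lemma integral_affine_substitution (g : ℝ → ℝ) (τ : ℝ) {σ : ℝ} (hσ : 0 < σ) :
    ∫ t, g t = σ * ∫ u, g (τ + σ * u) := by
  rw [Measure.integral_comp_mul_left (fun x => g (τ + x)) σ, integral_add_left_eq_self,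
    abs_of_pos (inv_pos.2 hσ), smul_eq_mul, mul_inv_cancel_left₀ hσ.ne']

lemma integral_eq_rescaled_laplace {C d r τ : ℝ} (b η : ℝ) (hd : 0 < d) (hr : 0 < r)
    (hτ : 0 < τ) (h_crit : r * τ ^ (d + 1) = C * d) :
    ∫ t in Set.Ioc (0 : ℝ) η, exp (-r * t) * t ^ b * exp (-C / t ^ d) =
      τ / √(r * τ) * τ ^ b * exp (-(r * τ * ((d + 1) / d))) *
        ∫ u : ℝ, (Set.Ioc 0 (η / τ)).indicator
          (fun s => s ^ b * exp (-(r * τ * laplacePhase d s))) (1 + u / √(r * τ)) := by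
  have hA : 0 < √(r * τ) := sqrt_pos.2 (by positivity)
  rw [← integral_indicator measurableSet_Ioc,
    integral_affine_substitution _ τ (div_pos hτ hA), mul_assoc (τ / √(r * τ)),
    mul_assoc (τ / √(r * τ)),
    ← integral_const_mul (τ ^ b * exp (-(r * τ * ((d + 1) / d))))]
  refine congrArg (τ / √(r * τ) * ·) (integral_congr_ae (Eventually.of_forall fun u => ?_))
  beta_reduce
  have h_arg : τ + τ / √(r * τ) * u = τ * (1 + u / √(r * τ)) := by ring
  rw [h_arg]
  generalize 1 + u / √(r * τ) = s
  have h_mem : τ * s ∈ Set.Ioc 0 η ↔ s ∈ Set.Ioc 0 (η / τ) := by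
    simp only [Set.mem_Ioc, mul_pos_iff_of_pos_left hτ, le_div_iff₀ hτ, mul_comm]
  by_cases hs : s ∈ Set.Ioc 0 (η / τ)
  · rw [Set.indicator_of_mem hs, Set.indicator_of_mem (h_mem.2 hs)]
    have hs0 := hs.1
    have h_exp : -C / (τ * s) ^ d = -(r * τ * (s ^ (-d) / d)) := by
      rw [rpow_add_one hτ.ne'] at h_crit
      rw [mul_rpow hτ.le hs0.le, rpow_neg hs0.le]
      field_simp
      linarith
    rw [h_exp, mul_rpow hτ.le hs0.le, mul_right_comm, ← exp_add,
      show -r * (τ * s) + -(r * τ * (s ^ (-d) / d)) =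
        -(r * τ * ((d + 1) / d)) + -(r * τ * laplacePhase d s) by
          unfold laplacePhase; field_simp; ring, exp_add]
    ring
  · rw [Set.indicator_of_notMem hs, Set.indicator_of_notMem (mt h_mem.1 hs), mul_zero]

theorem laplace_method_asymptotics
    (C d b η : ℝ) (hC : 0 < C) (hd : 0 < d) (hη : 0 < η)
    (μ β γ : ℝ)
    (hμ : μ = Real.sqrt (2 * π * (C * d) ^ ((2 * b + 1) / (d + 1)) / (d + 1)))
    (hβ : β = (d - 2 * b) / (2 * d + 2))
    (hγ : γ = ((d + 1) / d ^ (d / (d + 1))) * C ^ (1 / (d + 1))) :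
    Tendsto (fun r : ℝ =>
        (∫ t in Set.Ioc (0 : ℝ) η, Real.exp (-r * t) * t ^ b * Real.exp (-C / t ^ d)) /
          (μ * r ^ (β - 1) * Real.exp (-γ * r ^ (d / (d + 1)))))
      atTop (nhds 1) := by
  have hd1 : 0 < d + 1 := by linarith
  set τ : ℝ → ℝ := fun r => (C * d / r) ^ (1 / (d + 1)) with hτ_def
  have hτ : ∀ r, 0 < r → 0 < τ r := fun r hr => by positivity
  have h_logτ : ∀ r, 0 < r → log (τ r) = 1 / (d + 1) * (log C + log d - log r) := by
    intro r hr
    rw [hτ_def, log_rpow (by positivity), log_div (by positivity) hr.ne',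
      log_mul hC.ne' hd.ne']
  have hA : Tendsto (fun r => r * τ r) atTop atTop := by
    have h := (tendsto_rpow_atTop (show 0 < d / (d + 1) by positivity)).const_mul_atTop
      (show 0 < (C * d) ^ (1 / (d + 1)) by positivity)
    refine h.congr' ?_
    filter_upwards [eventually_gt_atTop 0] with r hr
    have := hτ r hr
    refine log_injOn_pos (Set.mem_Ioi.2 (by positivity)) (Set.mem_Ioi.2 (by positivity)) ?_
    rw [log_mul hr.ne' this.ne', h_logτ r hr, log_mul (by positivity) (by positivity),
      log_rpow (by positivity), log_rpow hr, log_mul hC.ne' hd.ne']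
    field_simp
    ring
  have hM : Tendsto (fun r => η / τ r) atTop atTop := by
    have h := (tendsto_rpow_atTop (show 0 < 1 / (d + 1) by positivity)).const_mul_atTop
      (show 0 < η / (C * d) ^ (1 / (d + 1)) by positivity)
    refine h.congr' ?_
    filter_upwards [eventually_gt_atTop 0] with r hr
    simp only [hτ_def]
    rw [div_rpow (by positivity) hr.le]
    field_simp
  have h_lim := (tendsto_integral_rescaled_laplace b hd hA hM).div_const √(2 * π / (d + 1))
  rw [div_self (by positivity)] at h_lim
  refine h_lim.congr' ?_
  filter_upwards [eventually_gt_atTop 0] with r hr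
  have hτr := hτ r hr
  have h_crit : r * τ r ^ (d + 1) = C * d := by
    rw [hτ_def, ← rpow_mul (by positivity), one_div_mul_cancel hd1.ne', rpow_one]
    field_simp
  have h_exponent : γ * r ^ (d / (d + 1)) = r * τ r * ((d + 1) / d) := by
    rw [hγ]
    refine log_injOn_pos (Set.mem_Ioi.2 (by positivity)) (Set.mem_Ioi.2 (by positivity)) ?_
    rw [log_mul (by positivity) (by positivity), log_mul (by positivity) (by positivity),
      log_mul (by positivity) (by positivity), log_mul hr.ne' hτr.ne',
      log_div hd1.ne' (by positivity), log_div hd1.ne' hd.ne', log_rpow hd, log_rpow hC,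
      log_rpow hr, h_logτ r hr]
    field_simp
    ring
  have h_prefactor : μ * r ^ (β - 1) =
      τ r / √(r * τ r) * τ r ^ b * √(2 * π / (d + 1)) := by
    rw [hμ, hβ, mul_div_right_comm, sqrt_mul (by positivity)]
    rw [mul_assoc, mul_comm]
    congr 1
    refine log_injOn_pos (Set.mem_Ioi.2 (by positivity)) (Set.mem_Ioi.2 (by positivity)) ?_
    rw [log_mul (by positivity) (by positivity), log_mul (by positivity) (by positivity),
      log_div hτr.ne' (by positivity), log_sqrt (by positivity), log_sqrt (by positivity),
      log_mul hr.ne' hτr.ne', log_rpow (by positivity), log_rpow hr, log_rpow hτr,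
      log_mul hC.ne' hd.ne', h_logτ r hr]
    field_simp
    ring
  rw [integral_eq_rescaled_laplace b η hd hr hτr h_crit, neg_mul, h_exponent, h_prefactor]
  rw [mul_right_comm _ √(2 * π / (d + 1)), mul_div_mul_left _ _ (by positivity)]
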